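/- arXiv:2407.04455 — 4 statements merged into one kernel-verified Lean document; each statement's English description precedes it below -/
import Mathlib

section
/- Let T ≥ 0 and let h : [0,T] → ℝ be a differentiable function satisfying h'(t) ≤ 1 − h(t)² for all t ∈ [0,T] and h(0) < −1. Then T < (1/2)·log((h(0) − 1)/(h(0) + 1)). -/
/-- A solution of `h' ≤ 1 - h²` starting below `-1` never exceeds its initial value. -/
theorem le_initial_of_riccati (T : ℝ) (h h' : ℝ → ℝ)
    (hderiv : ∀ t ∈ Set.Icc (0:ℝ) T, HasDerivWithinAt h (h' t) (Set.Icc 0 T) t)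
    (hineq : ∀ t ∈ Set.Icc (0:ℝ) T, h' t ≤ 1 - (h t) ^ 2)
    (h0 : h 0 < -1) {t : ℝ} (ht : t ∈ Set.Icc (0:ℝ) T) : h t ≤ h 0 := by
  refine image_le_of_deriv_right_lt_deriv_boundary (f' := h') (B := fun _ => h 0)
    (B' := fun _ => 0) (fun x hx => (hderiv x hx).continuousWithinAt)
    (fun x hx => (hderiv x (Set.Ico_subset_Icc_self hx)).mono_of_mem_nhdsWithin
      (Icc_mem_nhdsGE_of_mem hx)) le_rfl (fun x => hasDerivAt_const x _) ?_ ht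
  intro x hx hxe
  have := hineq x (Set.Ico_subset_Icc_self hx)
  rw [hxe] at this
  nlinarith

/-- Riccati blow-up: if `h' ≤ 1 - h²` on `[0,T]` and `h 0 < -1`, then
`T < (1/2)·log ((h 0 - 1)/(h 0 + 1))`. -/
theorem stmt_4 (T : ℝ) (hT : 0 ≤ T) (h h' : ℝ → ℝ)
    (hderiv : ∀ t ∈ Set.Icc (0:ℝ) T, HasDerivWithinAt h (h' t) (Set.Icc 0 T) t)
    (hineq : ∀ t ∈ Set.Icc (0:ℝ) T, h' t ≤ 1 - (h t) ^ 2)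
    (h0 : h 0 < -1) :
    T < (1 / 2) * Real.log ((h 0 - 1) / (h 0 + 1)) := by
  have hlt : ∀ t ∈ Set.Icc (0:ℝ) T, h t < -1 := fun t ht =>
    (le_initial_of_riccati T h h' hderiv hineq h0 ht).trans_lt h0
  have hlog : ∀ t ∈ Set.Icc (0:ℝ) T, HasDerivWithinAt
      (fun s => (1 / 2) * (Real.log (h s - 1) - Real.log (h s + 1)))
      ((1 / 2) * (h' t / (h t - 1) - h' t / (h t + 1))) (Set.Icc 0 T) t := by
    intro t ht
    have := hlt t ht
    exact ((((hderiv t ht).sub_const 1).log (by linarith)).sub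
      (((hderiv t ht).add_const 1).log (by linarith))).const_mul (1 / 2)
  have hle := image_le_of_deriv_right_le_deriv_boundary
    (B := fun t => (1 / 2) * (Real.log (h 0 - 1) - Real.log (h 0 + 1)) - t)
    (B' := fun _ => -1) (fun x hx => (hlog x hx).continuousWithinAt)
    (fun x hx => (hlog x (Set.Ico_subset_Icc_self hx)).mono_of_mem_nhdsWithin
      (Icc_mem_nhdsGE_of_mem hx)) (by simp) (by fun_prop)
    (fun x _ => ((hasDerivAt_id x).const_sub _).hasDerivWithinAt) (by
      intro x hx
      have hx' := Set.Ico_subset_Icc_self hx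
      have h1 := hlt x hx'
      have h2 := hineq x hx'
      have hm : h x - 1 ≠ 0 := by linarith
      have hp : h x + 1 ≠ 0 := by linarith
      have hpos : 0 < (h x) ^ 2 - 1 := by nlinarith
      have heq : (1 / 2) * (h' x / (h x - 1) - h' x / (h x + 1)) = h' x / ((h x) ^ 2 - 1) := by
        rw [show (h x) ^ 2 - 1 = (h x - 1) * (h x + 1) by ring]
        field_simp
        ring
      rw [heq, div_le_iff₀ hpos]
      linarith)
    (Set.right_mem_Icc.2 hT)
  have hTlt := hlt T (Set.right_mem_Icc.2 hT)
  have hpos : Real.log (h T + 1) < Real.log (h T - 1) := by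
    rw [← Real.log_neg_eq_log (h T + 1), ← Real.log_neg_eq_log (h T - 1)]
    exact Real.log_lt_log (by linarith) (by linarith)
  rw [Real.log_div (by linarith) (by linarith)]
  linarith
end

section
/- Let κ < 0 and let h : [0,∞) → ℝ be a differentiable function satisfying h'(t) ≤ −κ − h(t)² for all t ≥ 0 and h(0) ≤ −√(−κ). Then h(t) = −√(−κ) for all t ≥ 0. -/
/-- A function on `[s, ∞)` with derivative bounded above by a multiple of itself,
`u' ≤ c u`, has `u t * exp (-c t)` antitone. -/
theorem antitoneOn_mul_exp_of_deriv_le {u u' : ℝ → ℝ} {c s : ℝ}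
    (hu : ∀ t ∈ Set.Ici s, HasDerivWithinAt u (u' t) (Set.Ici s) t)
    (hle : ∀ t ∈ Set.Ici s, u' t ≤ c * u t) :
    AntitoneOn (fun t => u t * Real.exp (-c * t)) (Set.Ici s) := by
  have hd : ∀ t ∈ Set.Ici s, HasDerivWithinAt (fun t => u t * Real.exp (-c * t))
      (u' t * Real.exp (-c * t) + u t * (Real.exp (-c * t) * (-c * 1))) (Set.Ici s) t :=
    fun t ht => (hu t ht).mul (((hasDerivAt_id t).const_mul (-c)).exp.hasDerivWithinAt)
  refine antitoneOn_of_hasDerivWithinAt_nonpos (convex_Ici s)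
    (fun t ht => (hd t ht).continuousWithinAt)
    (fun t ht => (hd t (interior_subset ht)).mono interior_subset) fun t ht => ?_
  nlinarith [mul_nonneg (sub_nonneg.2 (hle t (interior_subset ht))) (Real.exp_pos (-c * t)).le]

/-- There is no negative function on `[s, ∞)` with `u' ≤ -u²`: it blows up in finite time. -/
theorem not_forall_neg_of_deriv_le_neg_sq {u u' : ℝ → ℝ} {s : ℝ}
    (hu : ∀ t ∈ Set.Ici s, HasDerivWithinAt u (u' t) (Set.Ici s) t)
    (hle : ∀ t ∈ Set.Ici s, u' t ≤ -(u t) ^ 2) :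
    ¬ ∀ t ∈ Set.Ici s, u t < 0 := by
  intro hneg
  have hd : ∀ t ∈ Set.Ici s, HasDerivWithinAt (fun t => (u t)⁻¹ - t)
      (-u' t / (u t) ^ 2 - 1) (Set.Ici s) t :=
    fun t ht => ((hu t ht).fun_inv (hneg t ht).ne).sub (hasDerivWithinAt_id t _)
  have hmono : MonotoneOn (fun t => (u t)⁻¹ - t) (Set.Ici s) := by
    refine monotoneOn_of_hasDerivWithinAt_nonneg (convex_Ici s)
      (fun t ht => (hd t ht).continuousWithinAt)
      (fun t ht => (hd t (interior_subset ht)).mono interior_subset) fun t ht => ?_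
    have ht' := interior_subset ht
    rw [sub_nonneg, one_le_div (sq_pos_of_neg (hneg t ht'))]
    linarith [hle t ht']
  have hs : (u s)⁻¹ < 0 := inv_lt_zero.2 (hneg s Set.self_mem_Ici)
  have hT : s ≤ s - (u s)⁻¹ := by linarith
  have h1 := hmono Set.self_mem_Ici hT hT
  have h2 : (u (s - (u s)⁻¹))⁻¹ < 0 := inv_lt_zero.2 (hneg _ hT)
  simp only at h1
  linarith

/-- Riccati rigidity: if `κ < 0`, `h' ≤ -κ - h²` on `[0,∞)` and `h 0 ≤ -√(-κ)`, then
`h ≡ -√(-κ)`. -/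
theorem stmt_5 (κ : ℝ) (hκ : κ < 0) (h h' : ℝ → ℝ)
    (hderiv : ∀ t ∈ Set.Ici (0:ℝ), HasDerivWithinAt h (h' t) (Set.Ici 0) t)
    (hineq : ∀ t ∈ Set.Ici (0:ℝ), h' t ≤ -κ - (h t) ^ 2)
    (h0 : h 0 ≤ -Real.sqrt (-κ)) :
    ∀ t ∈ Set.Ici (0:ℝ), h t = -Real.sqrt (-κ) := by
  set a := Real.sqrt (-κ) with ha
  have ha0 : 0 ≤ a := Real.sqrt_nonneg _
  have hasq : a ^ 2 = -κ := Real.sq_sqrt (by linarith)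
  have hu : ∀ t ∈ Set.Ici (0:ℝ), HasDerivWithinAt (fun t => h t + a) (h' t) (Set.Ici 0) t :=
    fun t ht => (hderiv t ht).add_const a
  have hanti := antitoneOn_mul_exp_of_deriv_le (c := 2 * a) hu fun t ht => by
    nlinarith [hineq t ht, sq_nonneg (h t + a)]
  intro t (ht : 0 ≤ t)
  have hle : h t ≤ -a := by
    have h1 : (h t + a) * Real.exp (-(2 * a) * t) ≤ (h 0 + a) * Real.exp (-(2 * a) * 0) :=
      hanti Set.self_mem_Ici ht ht
    have h2 : (h 0 + a) * Real.exp (-(2 * a) * 0) ≤ 0 :=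
      mul_nonpos_of_nonpos_of_nonneg (by linarith) (Real.exp_pos _).le
    linarith [nonpos_of_mul_nonpos_left (h1.trans h2) (Real.exp_pos _)]
  by_contra hne
  have hlt : h t + a < 0 := by linarith [lt_of_le_of_ne hle hne]
  have hneg : ∀ r ∈ Set.Ici t, h r + a < 0 := fun r (hr : t ≤ r) => by
    have h1 : (h r + a) * Real.exp (-(2 * a) * r) ≤ (h t + a) * Real.exp (-(2 * a) * t) :=
      hanti ht (ht.trans hr) hr
    exact neg_of_mul_neg_left (h1.trans_lt (mul_neg_of_neg_of_pos hlt (Real.exp_pos _)))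
      (Real.exp_pos _).le
  refine not_forall_neg_of_deriv_le_neg_sq
    (fun r hr => (hu r (ht.trans hr)).mono (Set.Ici_subset_Ici.2 ht)) (fun r hr => ?_) hneg
  nlinarith [hineq r (ht.trans hr), mul_nonneg ha0 (neg_nonneg.2 (hneg r hr).le)]
end

section
/- Let h : [0,∞) → ℝ be differentiable and let r, s : [0,∞) → ℝ be functions such that h'(t) = −r(t) − h(t)² − s(t), r(t) ≥ −1, and s(t) ≥ 0 for all t ≥ 0, and such that h(0) ≤ −1. Then h(t) = −1, r(t) = −1, and s(t) = 0 for all t ≥ 0. -/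
lemma antitoneOn_Ici_of_hasDerivWithinAt_nonpos {a : ℝ} {f f' : ℝ → ℝ}
    (hf : ∀ t ∈ Set.Ici a, HasDerivWithinAt f (f' t) (Set.Ici a) t)
    (hf' : ∀ t ∈ Set.Ici a, f' t ≤ 0) : AntitoneOn f (Set.Ici a) :=
  antitoneOn_of_hasDerivWithinAt_nonpos (convex_Ici a)
    (fun t ht => (hf t ht).continuousWithinAt)
    (fun t ht => (hf t (interior_subset ht)).mono interior_subset)
    (fun t ht => hf' t (interior_subset ht))

/-- A solution of the Riccati inequality `z' ≤ -z²` on a half-line is nonnegative. -/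
lemma nonneg_of_hasDerivWithinAt_le_neg_sq {a : ℝ} {z z' : ℝ → ℝ}
    (hz : ∀ t ∈ Set.Ici a, HasDerivWithinAt z (z' t) (Set.Ici a) t)
    (hz' : ∀ t ∈ Set.Ici a, z' t ≤ -(z t) ^ 2) : ∀ t ∈ Set.Ici a, 0 ≤ z t := by
  intro b hb
  by_contra! hneg
  have hanti : AntitoneOn z (Set.Ici a) :=
    antitoneOn_Ici_of_hasDerivWithinAt_nonpos hz fun t ht =>
      (hz' t ht).trans (neg_nonpos.2 (sq_nonneg _))
  have hsub : Set.Ici b ⊆ Set.Ici a := Set.Ici_subset_Ici.2 hb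
  have hlt : ∀ t ∈ Set.Ici b, z t < 0 := fun t ht =>
    (hanti hb (hsub ht) ht).trans_lt hneg
  have hinv : AntitoneOn (fun t => t - (z t)⁻¹) (Set.Ici b) := by
    refine antitoneOn_Ici_of_hasDerivWithinAt_nonpos
      (f' := fun t => 1 - -z' t / (z t) ^ 2) (fun t ht => ?_) fun t ht => ?_
    · exact (hasDerivWithinAt_id t _).sub (((hz t (hsub ht)).mono hsub).inv (hlt t ht).ne)
    · have hpos : 0 < (z t) ^ 2 := sq_pos_of_neg (hlt t ht)
      rw [sub_nonpos, le_div_iff₀ hpos]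
      linarith [hz' t (hsub ht)]
  have hzb : (z b)⁻¹ < 0 := inv_lt_zero.2 hneg
  have hc : b - (z b)⁻¹ ∈ Set.Ici b := by
    rw [Set.mem_Ici]
    linarith
  have hle := hinv Set.self_mem_Ici hc hc
  have hzc : (z (b - (z b)⁻¹))⁻¹ < 0 := inv_lt_zero.2 (hlt _ hc)
  simp only at hle
  linarith

/-- Full Raychaudhuri rigidity: if `h' = -r - h² - s` on `[0,∞)` with `r ≥ -1`, `s ≥ 0`
and `h 0 ≤ -1`, then `h ≡ -1`, `r ≡ -1` and `s ≡ 0`. -/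
theorem stmt_6 (h r s : ℝ → ℝ)
    (hderiv : ∀ t ∈ Set.Ici (0:ℝ),
      HasDerivWithinAt h (-r t - (h t) ^ 2 - s t) (Set.Ici 0) t)
    (hr : ∀ t ∈ Set.Ici (0:ℝ), -1 ≤ r t)
    (hs : ∀ t ∈ Set.Ici (0:ℝ), 0 ≤ s t)
    (h0 : h 0 ≤ -1) :
    ∀ t ∈ Set.Ici (0:ℝ), h t = -1 ∧ r t = -1 ∧ s t = 0 := by
  set z : ℝ → ℝ := fun t => (h t + 1) * Real.exp (-2 * t) with hz_def
  set z' : ℝ → ℝ := fun t => (-r t - (h t) ^ 2 - s t) * Real.exp (-2 * t)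
    + (h t + 1) * (Real.exp (-2 * t) * (-2)) with hz'_def
  have hz : ∀ t ∈ Set.Ici (0:ℝ), HasDerivWithinAt z (z' t) (Set.Ici 0) t := fun t ht => by
    have hlin : HasDerivAt (fun t : ℝ => -2 * t) (-2) t := by
      simpa using (hasDerivAt_id t).const_mul (-2 : ℝ)
    exact ((hderiv t ht).add_const 1).mul hlin.exp.hasDerivWithinAt
  have hz' : ∀ t ∈ Set.Ici (0:ℝ), z' t ≤ -(z t) ^ 2 := fun t ht => by
    have hexp : 0 < Real.exp (-2 * t) := Real.exp_pos _
    have hexp_le : Real.exp (-2 * t) ≤ 1 :=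
      Real.exp_le_one_iff.2 (by linarith [Set.mem_Ici.1 ht])
    have hdecay : (h t + 1) ^ 2 * Real.exp (-2 * t) ≤ (h t + 1) ^ 2 :=
      mul_le_of_le_one_right (sq_nonneg _) hexp_le
    have hfactor : -r t - (h t) ^ 2 - s t - 2 * (h t + 1)
        + (h t + 1) ^ 2 * Real.exp (-2 * t) ≤ 0 := by
      linarith [hr t ht, hs t ht]
    have hprod := mul_nonpos_of_nonpos_of_nonneg hfactor hexp.le
    simp only [hz_def, hz'_def]
    linarith
  have hanti : AntitoneOn z (Set.Ici 0) :=
    antitoneOn_Ici_of_hasDerivWithinAt_nonpos hz fun t ht =>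
      (hz' t ht).trans (neg_nonpos.2 (sq_nonneg _))
  have hh : ∀ t ∈ Set.Ici (0:ℝ), h t = -1 := fun t ht => by
    have hz0 : z 0 ≤ 0 := by
      simp only [hz_def, mul_zero, Real.exp_zero, mul_one]
      linarith
    have hzt : z t = 0 := le_antisymm ((hanti Set.self_mem_Ici ht ht).trans hz0)
      (nonneg_of_hasDerivWithinAt_le_neg_sq hz hz' t ht)
    have := (mul_eq_zero.1 hzt).resolve_right (Real.exp_pos _).ne'
    linarith
  intro t ht
  have hzero : -r t - (h t) ^ 2 - s t = 0 :=
    (uniqueDiffOn_Ici 0 t ht).eq_deriv _ (hderiv t ht)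
      ((hasDerivWithinAt_const t _ (-1)).congr hh (hh t ht))
  rw [hh t ht] at hzero
  have hrt := hr t ht
  have hst := hs t ht
  exact ⟨hh t ht, by linarith, by linarith⟩
end

section
/- Define f : ℝ → ℝ by f(x) = 2 + (x − 2n)/2 for x ∈ [2n, 2n+1) and f(x) = 3 − (x − 2n)/2 for x ∈ [2n+1, 2n+2), for each integer n, and let M = {(t,x) ∈ ℝ² : 0 < t < f(x)}. Then for every (t,x) ∈ M, the supremum of √((t − t')² − (x − x')²) over all (t',x') ∈ M with t' ≤ t and |x − x'| ≤ t − t' equals t. -/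
/-- For the sawtooth function `f` of Example 3.4 and
`M = {(t,x) : 0 < t < f x}` in 2d Minkowski space, the cosmological time function of `M`
is `τ(t,x) = t`: the supremum of the Lorentzian distances `√((t-t')² - (x-x')²)` over
points `(t',x') ∈ M` in the causal past of `(t,x)` equals `t`. -/
theorem stmt_15 (f : ℝ → ℝ)
    (hf1 : ∀ n : ℤ, ∀ x : ℝ, (2 * n : ℝ) ≤ x → x < 2 * n + 1 →
      f x = 2 + (x - 2 * n) / 2)
    (hf2 : ∀ n : ℤ, ∀ x : ℝ, (2 * n + 1 : ℝ) ≤ x → x < 2 * n + 2 →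
      f x = 3 - (x - 2 * n) / 2) :
    ∀ t x : ℝ, 0 < t → t < f x →
      sSup {d : ℝ | ∃ t' x' : ℝ, (0 < t' ∧ t' < f x') ∧ t' ≤ t ∧
        |x - x'| ≤ t - t' ∧ d = Real.sqrt ((t - t') ^ 2 - (x - x') ^ 2)} = t := by
  intro t x ht htf
  apply csSup_eq_of_forall_le_of_forall_lt_exists_gt
  · exact ⟨_, t, x, ⟨ht, htf⟩, le_rfl, by simp, rfl⟩
  · rintro d ⟨t', x', ⟨ht', -⟩, htt, -, rfl⟩
    rw [Real.sqrt_le_left ht.le]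
    nlinarith [sq_nonneg (x - x')]
  · intro w hw
    obtain ⟨d, hd, hdt⟩ := exists_between (max_lt hw ht)
    obtain ⟨hwd, hd0⟩ := max_lt_iff.mp hd
    refine ⟨d, ⟨t - d, x, ⟨by linarith, by linarith⟩, by linarith, ?_, ?_⟩, hwd⟩
    · simpa using hd0.le
    · simp [Real.sqrt_sq hd0.le]
end
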